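/- For every integer n ≥ 3, every 3-regular, weakly connected, acyclic finite directed multigraph on 2n vertices with a unique source and a unique sink has at most 9 · 2^{n−3} source-to-sink paths. -/

import Mathlib

/-- A finite directed multigraph with vertex set `Fin m` and edge set `Fin q`,
given by source and target maps. -/
structure Multigraph (m q : ℕ) where
  src : Fin q → Fin m
  tgt : Fin q → Fin m

namespace Multigraph

variable {m q : ℕ}

/-- `p` is a directed path from `u` to `v`: a nonempty list of edges whose first edge
starts at `u`, whose last edge ends at `v`, and where consecutive edges are composable. -/
def IsPath (D : Multigraph m q) (u v : Fin m) (p : List (Fin q)) : Prop :=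
  (∃ e rest, p = e :: rest ∧ D.src e = u) ∧
  (∃ e rest, p = rest ++ [e] ∧ D.tgt e = v) ∧
  p.Chain' (fun a b => D.tgt a = D.src b)

/-- The number of directed paths from `u` to `v` (paths counted as edge sequences). -/
noncomputable def pathCount (D : Multigraph m q) (u v : Fin m) : ℕ :=
  Nat.card {p : List (Fin q) // D.IsPath u v p}

/-- `D` is acyclic: no vertex has a directed path to itself. -/
def Acyclic (D : Multigraph m q) : Prop :=
  ∀ v : Fin m, ¬ ∃ p, D.IsPath v v p

/-- In-degree of a vertex. -/
def indeg (D : Multigraph m q) (v : Fin m) : ℕ :=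
  (Finset.univ.filter (fun e => D.tgt e = v)).card

/-- Out-degree of a vertex. -/
def outdeg (D : Multigraph m q) (v : Fin m) : ℕ :=
  (Finset.univ.filter (fun e => D.src e = v)).card

/-- `D` is 3-regular: every vertex has total degree 3. -/
def ThreeRegular (D : Multigraph m q) : Prop :=
  ∀ v : Fin m, D.indeg v + D.outdeg v = 3

/-- `s` is the unique source (vertex of in-degree 0) of `D`. -/
def UniqueSource (D : Multigraph m q) (s : Fin m) : Prop :=
  D.indeg s = 0 ∧ ∀ v : Fin m, D.indeg v = 0 → v = s

/-- `t` is the unique sink (vertex of out-degree 0) of `D`. -/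
def UniqueSink (D : Multigraph m q) (t : Fin m) : Prop :=
  D.outdeg t = 0 ∧ ∀ v : Fin m, D.outdeg v = 0 → v = t

/-- `μ_D(v)`: the number of directed paths from `s` to `v`, with `μ_D(s) = 1`. -/
noncomputable def mu (D : Multigraph m q) (s v : Fin m) : ℕ :=
  if v = s then 1 else D.pathCount s v

/-- Two vertices are adjacent (disregarding orientation) via an edge in `S`. -/
def Adj (D : Multigraph m q) (S : Set (Fin q)) (a b : Fin m) : Prop :=
  ∃ e ∈ S, (D.src e = a ∧ D.tgt e = b) ∨ (D.src e = b ∧ D.tgt e = a)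

/-- Weak connectivity using only the edges in `S`: any two distinct vertices are joined
by a finite sequence of edges of `S` traversed in either direction. -/
def WeaklyConnectedOn (D : Multigraph m q) (S : Set (Fin q)) : Prop :=
  ∀ a b : Fin m, a ≠ b → Relation.ReflTransGen (D.Adj S) a b

/-- `D` is weakly connected. -/
def WeaklyConnected (D : Multigraph m q) : Prop :=
  D.WeaklyConnectedOn Set.univ

/-- `D` is `ℓ`-edge connected: it has at least two vertices, and deleting any set of at
most `ℓ - 1` edges leaves a weakly connected multigraph. -/
def EdgeConnected (D : Multigraph m q) (ℓ : ℕ) : Prop :=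
  2 ≤ m ∧ ∀ F : Finset (Fin q), F.card ≤ ℓ - 1 → D.WeaklyConnectedOn {e | e ∉ F}

/-- `p` is a directed Hamiltonian path of `D` starting at `u`: a directed path that
visits every vertex exactly once. -/
def IsHamiltonianPath (D : Multigraph m q) (u : Fin m) (p : List (Fin q)) : Prop :=
  (∃ v, D.IsPath u v p) ∧ (u :: p.map D.tgt).Nodup ∧
    ∀ w : Fin m, w ∈ u :: p.map D.tgt

/-- `D` contains a directed Hamiltonian path. -/
def HasHamiltonianPath (D : Multigraph m q) : Prop :=
  ∃ u p, D.IsHamiltonianPath u p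

/-- `D` is simple: no two distinct edges have the same unordered pair of endpoints. -/
def Simple (D : Multigraph m q) : Prop :=
  ∀ e e' : Fin q, e ≠ e' →
    ¬ ((D.src e = D.src e' ∧ D.tgt e = D.tgt e') ∨
       (D.src e = D.tgt e' ∧ D.tgt e = D.src e'))

/-- `D` together with designated edges `H i` (from vertex `i` to vertex `i+1`, 0-based)
is a Hamiltonian-path digraph: the designated edges are pairwise distinct, form the
Hamiltonian path, and every edge goes from a smaller vertex to a larger one.
(Vertices `0, …, m-1` here represent the vertices `1, …, m`.) -/
def IsHamPathDigraph (D : Multigraph m q) (H : Fin (m - 1) → Fin q) : Prop :=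
  Function.Injective H ∧
  (∀ i : Fin (m - 1), (D.src (H i)).val = i.val ∧ (D.tgt (H i)).val = i.val + 1) ∧
  ∀ e : Fin q, (D.src e).val < (D.tgt e).val

end Multigraph
/-- `Evolves k l M N`: the multiset `N` arises from `M` by `k` duplications of an element
and `l` replacements of two elements by their sum. -/
inductive Evolves : ℕ → ℕ → Multiset ℕ → Multiset ℕ → Prop
  | refl (M : Multiset ℕ) : Evolves 0 0 M M
  | split {k l : ℕ} {N : Multiset ℕ} (x : ℕ) (M : Multiset ℕ)
      (h : Evolves k l (x ::ₘ x ::ₘ M) N) : Evolves (k + 1) l (x ::ₘ M) N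
  | merge {k l : ℕ} {N : Multiset ℕ} (x y : ℕ) (M : Multiset ℕ)
      (h : Evolves k l ((x + y) ::ₘ M) N) : Evolves k (l + 1) (x ::ₘ y ::ₘ M) N

namespace Evolves

variable {k l : ℕ} {M N : Multiset ℕ}

theorem card_add (h : Evolves k l M N) : M.card + k = N.card + l := by
  induction h with
  | refl M => rfl
  | split x M _ ih => simp only [Multiset.card_cons] at ih ⊢; omega
  | merge x y M _ ih => simp only [Multiset.card_cons] at ih ⊢; omega

theorem sum_le (h : Evolves k l M N) : N.sum ≤ 2 ^ k * M.sum := by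
  induction h with
  | refl M => simp
  | split x M _ ih =>
    simp only [Multiset.sum_cons] at ih ⊢
    refine ih.trans ?_
    rw [pow_succ, mul_assoc]
    exact Nat.mul_le_mul_left _ (by omega)
  | merge x y M _ ih =>
    simp only [Multiset.sum_cons] at ih ⊢
    rwa [← add_assoc]

theorem sum_le_of_singleton (h : Evolves k l M N) {x : ℕ} (hM : M = {x}) (hN : N.card = 3) :
    4 * N.sum ≤ 3 * x * 2 ^ k := by
  induction k using Nat.strong_induction_on generalizing l M x with
  | _ k ih =>
  subst hM
  generalize hM : ({x} : Multiset ℕ) = M at h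
  cases h with
  | refl => simp [← hM] at hN
  | merge a b M' h => simpa using congrArg Multiset.card hM
  | @split k l _ a M' h =>
    obtain ⟨rfl, rfl⟩ : x = a ∧ M' = 0 := by
      have := congrArg Multiset.card hM
      simp only [Multiset.card_singleton, Multiset.card_cons] at this
      obtain rfl : M' = 0 := Multiset.card_eq_zero.mp (by omega)
      simpa using hM
    generalize hP : x ::ₘ x ::ₘ (0 : Multiset ℕ) = P at h
    cases h with
    | refl => simp [← hP] at hN
    | @split k l _ b M' h =>
      have hsum := h.sum_le
      have hb : b = x := by
        have : b ∈ x ::ₘ x ::ₘ (0 : Multiset ℕ) := hP ▸ Multiset.mem_cons_self _ _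
        simpa using this
      have hS := congrArg Multiset.sum hP
      simp only [Multiset.sum_cons, Multiset.sum_zero] at hS hsum
      have : b + (b + M'.sum) = 3 * x := by omega
      rw [this] at hsum
      rw [pow_succ, pow_succ]
      nlinarith
    | @merge _ l _ a b M' h =>
      have hS := congrArg Multiset.sum hP
      have hC := congrArg Multiset.card hP
      simp only [Multiset.card_cons, Multiset.card_zero] at hC
      obtain rfl : M' = 0 := Multiset.card_eq_zero.mp (by omega)
      have := ih k (by omega) h rfl
      simp only [Multiset.sum_cons, Multiset.sum_zero] at hS
      have hab : a + b = 2 * x := by omega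
      rw [hab] at this
      rw [pow_succ]
      linarith

/-- Either the first step duplicates an element of `{a, b}`, adding at most `c` to the total,
or it merges `a` and `b` and `sum_le_of_singleton` applies. -/
theorem sum_le_of_pair (h : Evolves k l M N) {a b c : ℕ} (hM : M = {a, b}) (ha : a ≤ c)
    (hb : b ≤ c) (hN : N.card = 3) :
    2 * N.sum ≤ (a + b + c) * 2 ^ k := by
  subst hM
  generalize hM : ({a, b} : Multiset ℕ) = M at h
  have hS := congrArg Multiset.sum hM
  have hC := congrArg Multiset.card hM
  cases h with
  | refl => simp [← hM] at hN
  | split x M' h =>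
    have hx : x ≤ c := by
      have : x ∈ ({a, b} : Multiset ℕ) := hM ▸ Multiset.mem_cons_self _ _
      simp only [Multiset.insert_eq_cons, Multiset.mem_cons, Multiset.mem_singleton] at this
      omega
    have hsum := h.sum_le
    simp only [Multiset.insert_eq_cons, Multiset.sum_cons, Multiset.sum_singleton] at hS hsum
    have : x + (x + M'.sum) ≤ a + b + c := by omega
    have := hsum.trans (Nat.mul_le_mul_left _ this)
    rw [pow_succ]
    linarith
  | merge x y M' h =>
    simp only [Multiset.insert_eq_cons, Multiset.card_cons, Multiset.card_singleton] at hC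
    obtain rfl : M' = 0 := Multiset.card_eq_zero.mp (by omega)
    have := h.sum_le_of_singleton rfl hN
    simp only [Multiset.insert_eq_cons, Multiset.sum_cons, Multiset.sum_singleton,
      Multiset.sum_zero] at hS
    have hxy : x + y = a + b := by omega
    rw [hxy] at this
    have hp : 0 ≤ 2 ^ k := Nat.zero_le _
    nlinarith

theorem sum_le_of_one_two_two (h : Evolves k l M N) (hM : M = {1, 2, 2}) (hN : N.card = 3)
    (hk : k ≠ 0) : 2 * N.sum ≤ 9 * 2 ^ k := by
  subst hM
  generalize hM : ({1, 2, 2} : Multiset ℕ) = M at h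
  have hS := congrArg Multiset.sum hM
  have hC := congrArg Multiset.card hM
  have hmem : ∀ z ∈ M, z = 1 ∨ z = 2 := by simp [← hM]
  cases h with
  | refl => exact absurd rfl hk
  | split x M' h =>
    have hx := hmem x (Multiset.mem_cons_self _ _)
    have hsum := h.sum_le
    simp only [Multiset.insert_eq_cons, Multiset.sum_cons, Multiset.sum_singleton] at hS hsum
    have : x + (x + M'.sum) ≤ 7 := by omega
    have := hsum.trans (Nat.mul_le_mul_left _ this)
    omega
  | merge x y M' h =>
    simp only [Multiset.insert_eq_cons, Multiset.card_cons, Multiset.card_singleton] at hC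
    obtain ⟨z, rfl⟩ := Multiset.card_eq_one.mp (show M'.card = 1 by omega)
    have hz := hmem z (by simp)
    simp only [Multiset.insert_eq_cons, Multiset.sum_cons, Multiset.sum_singleton] at hS
    have := h.sum_le_of_pair (a := x + y) (b := z) (c := 4) rfl (by omega) (by omega) hN
    rwa [show x + y + z + 4 = 9 by omega] at this

theorem sum_le_of_one_two (h : Evolves k l M N) (hM : M = {1, 2}) (hN : N.card = 3)
    (hk : 2 ≤ k) : 4 * N.sum ≤ 9 * 2 ^ k := by
  subst hM
  generalize hM : ({1, 2} : Multiset ℕ) = M at h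
  have hS := congrArg Multiset.sum hM
  have hC := congrArg Multiset.card hM
  have hmem : ∀ z ∈ M, z = 1 ∨ z = 2 := by simp [← hM]
  cases h with
  | refl => omega
  | split x M' h =>
    have hx := hmem x (Multiset.mem_cons_self _ _)
    simp only [Multiset.insert_eq_cons, Multiset.card_cons, Multiset.card_singleton] at hC
    obtain ⟨z, rfl⟩ := Multiset.card_eq_one.mp (show M'.card = 1 by omega)
    simp only [Multiset.insert_eq_cons, Multiset.sum_cons, Multiset.sum_singleton] at hS
    rw [pow_succ]
    obtain rfl | rfl := hx
    · have hsum := h.sum_le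
      simp only [Multiset.sum_cons, Multiset.sum_singleton] at hsum
      rw [show 1 + (1 + z) = 4 by omega] at hsum
      omega
    · obtain rfl : z = 1 := by omega
      have := h.sum_le_of_one_two_two (by decide) hN (by omega)
      linarith
  | merge x y M' h =>
    simp only [Multiset.insert_eq_cons, Multiset.card_cons, Multiset.card_singleton] at hC
    obtain rfl : M' = 0 := Multiset.card_eq_zero.mp (by omega)
    have := h.sum_le_of_singleton rfl hN
    simp only [Multiset.insert_eq_cons, Multiset.sum_cons, Multiset.sum_singleton,
      Multiset.sum_zero] at hS
    rwa [show 3 * (x + y) = 9 by omega] at this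

theorem sum_le_of_replicate_three_one (h : Evolves k l M N) (hM : M = Multiset.replicate 3 1)
    (hN : N.card = 3) (hk : 2 ≤ k) : 4 * N.sum ≤ 9 * 2 ^ k := by
  have hS := congrArg Multiset.sum hM
  have hC := congrArg Multiset.card hM
  have hmem : ∀ z ∈ M, z = 1 := by
    intro z hz
    rw [hM] at hz
    exact Multiset.eq_of_mem_replicate hz
  simp only [Multiset.sum_replicate, Multiset.card_replicate, smul_eq_mul] at hS hC
  cases h with
  | refl => omega
  | split x M' h =>
    have hx := hmem x (Multiset.mem_cons_self _ _)
    have hsum := h.sum_le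
    simp only [Multiset.sum_cons] at hS hsum
    rw [show x + (x + M'.sum) = 4 by omega] at hsum
    omega
  | merge x y M' h =>
    obtain rfl := hmem x (by simp)
    obtain rfl := hmem y (by simp)
    simp only [Multiset.card_cons] at hC
    obtain ⟨z, rfl⟩ := Multiset.card_eq_one.mp (show M'.card = 1 by omega)
    obtain rfl := hmem z (by simp)
    exact h.sum_le_of_one_two (by decide) hN hk

end Evolves

namespace Multigraph

variable {m q : ℕ} {D : Multigraph m q}

theorem isPath_concat_iff {u v : Fin m} {p : List (Fin q)} {e : Fin q} :
    D.IsPath u v (p ++ [e]) ↔ D.tgt e = v ∧ (p = [] ∧ D.src e = u ∨ D.IsPath u (D.src e) p) := by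
  unfold IsPath
  rcases List.eq_nil_or_concat p with rfl | ⟨p', f, rfl⟩
  · constructor
    · rintro ⟨⟨a, r, h, h1⟩, ⟨b, r', h', h2⟩, -⟩
      simp only [List.nil_append, List.cons.injEq] at h
      obtain ⟨rfl, -⟩ := h
      obtain ⟨-, h''⟩ := List.append_inj' (s₁ := []) h' rfl
      simp only [List.cons.injEq, and_true] at h''
      subst h''
      exact ⟨h2, Or.inl ⟨rfl, h1⟩⟩
    · rintro ⟨h, ⟨-, h1⟩ | ⟨⟨a, r, h1, -⟩, -⟩⟩
      · exact ⟨⟨e, [], rfl, h1⟩, ⟨e, [], rfl, h⟩, List.isChain_singleton e⟩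
      · simp at h1
  · obtain ⟨g, r, hg⟩ : ∃ g r, p' ++ [f] = g :: r := by cases p' <;> simp
    constructor
    · rintro ⟨⟨a, r', h, h1⟩, ⟨b, r'', h', h2⟩, hc⟩
      obtain ⟨-, h''⟩ := List.append_inj' h' rfl
      simp only [List.cons.injEq, and_true] at h''
      subst h''
      rw [List.concat_eq_append] at *
      rw [List.Chain', List.isChain_append] at hc
      rw [hg, List.cons_append, List.cons.injEq] at h
      refine ⟨h2, Or.inr ⟨⟨g, r, hg, h.1 ▸ h1⟩, ⟨f, p', rfl, ?_⟩, hc.1⟩⟩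
      exact hc.2.2 f (by simp) e (by simp)
    · rintro ⟨h, ⟨h1, -⟩ | ⟨⟨a, r', h1, h2⟩, ⟨b, r'', h3, h4⟩, hc⟩⟩
      · simp at h1
      · refine ⟨⟨a, r' ++ [e], by rw [h1]; rfl, h2⟩, ⟨e, _, rfl, h⟩, ?_⟩
        rw [List.Chain', List.isChain_append]
        refine ⟨hc, by simp, ?_⟩
        rw [h3]
        simpa using h4

theorem Acyclic.wellFounded (h : D.Acyclic) :
    WellFounded fun u v => ∃ e, D.src e = u ∧ D.tgt e = v := by
  set r : Fin m → Fin m → Prop := fun u v => ∃ e, D.src e = u ∧ D.tgt e = v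
  have path : ∀ u v, Relation.TransGen r u v → ∃ p, D.IsPath u v p := by
    intro u v huv
    induction huv with
    | single h =>
      obtain ⟨e, he, he'⟩ := h
      exact ⟨[] ++ [e], isPath_concat_iff.mpr ⟨he', Or.inl ⟨rfl, he⟩⟩⟩
    | tail _ h ih =>
      obtain ⟨e, rfl, he'⟩ := h
      obtain ⟨p, hp⟩ := ih
      exact ⟨p ++ [e], isPath_concat_iff.mpr ⟨he', Or.inr hp⟩⟩
  have : Std.Irrefl (Relation.TransGen r) := ⟨fun v hv => h v (path v v hv)⟩
  exact Subrelation.wf (fun {_ _} => Relation.TransGen.single)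
    (Finite.wellFounded_of_trans_of_irrefl (Relation.TransGen r))

/-- `p` is a directed path from `s` to `v`, or the empty list if `v = s`. -/
def IsWalk (D : Multigraph m q) (s v : Fin m) (p : List (Fin q)) : Prop :=
  p = [] ∧ v = s ∨ D.IsPath s v p

theorem isWalk_concat_iff {s v : Fin m} {p : List (Fin q)} {e : Fin q} :
    D.IsWalk s v (p ++ [e]) ↔ D.tgt e = v ∧ D.IsWalk s (D.src e) p := by
  simp [IsWalk, isPath_concat_iff]

theorem not_isPath_nil {u v : Fin m} : ¬ D.IsPath u v [] := by
  rintro ⟨⟨e, r, h, -⟩, -⟩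
  simp at h

theorem Acyclic.mu_eq_card (h : D.Acyclic) (s v : Fin m) :
    D.mu s v = Nat.card {p // D.IsWalk s v p} := by
  unfold mu
  split_ifs with hv
  · subst hv
    have : Unique {p // D.IsWalk v v p} :=
      { default := ⟨[], Or.inl ⟨rfl, rfl⟩⟩
        uniq := by
          rintro ⟨p, hp | hp⟩
          · exact Subtype.ext hp.1
          · exact absurd ⟨p, hp⟩ (h v) }
    exact Nat.card_unique.symm
  · simp [pathCount, IsWalk, hv]

/-- A walk from `s` to another vertex `v` is a walk to the source of an edge into `v`,
followed by that edge. -/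
noncomputable def walkEquiv (D : Multigraph m q) {s v : Fin m} (hv : v ≠ s) :
    (Σ e : {e // D.tgt e = v}, {p // D.IsWalk s (D.src e) p}) ≃ {p // D.IsWalk s v p} :=
  Equiv.ofBijective
    (fun x => ⟨x.2.1 ++ [x.1.1], isWalk_concat_iff.mpr ⟨x.1.2, x.2.2⟩⟩) <| by
    constructor
    · rintro ⟨⟨e, he⟩, ⟨p, hp⟩⟩ ⟨⟨f, hf⟩, ⟨p', hp'⟩⟩ h
      obtain ⟨rfl, h'⟩ := List.append_inj' (congrArg Subtype.val h) rfl
      simp only [List.cons.injEq, and_true] at h'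
      subst h'
      rfl
    · rintro ⟨p, hp⟩
      rcases List.eq_nil_or_concat p with rfl | ⟨p', f, rfl⟩
      · rcases hp with hp | hp
        · exact absurd hp.2 hv
        · exact absurd hp not_isPath_nil
      · rw [List.concat_eq_append] at hp
        have := isWalk_concat_iff.mp hp
        exact ⟨⟨⟨f, this.1⟩, ⟨p', this.2⟩⟩, by simp⟩

theorem Acyclic.finite_walks (h : D.Acyclic) {s : Fin m} (hs : D.indeg s = 0) (v : Fin m) :
    Finite {p // D.IsWalk s v p} := by
  induction v using h.wellFounded.induction with
  | _ v ih =>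
  by_cases hv : v = s
  · subst hv
    have : Subsingleton {p // D.IsWalk v v p} := by
      constructor
      rintro ⟨p, hp | hp⟩ ⟨p', hp' | hp'⟩
      · exact Subtype.ext (hp.1.trans hp'.1.symm)
      · exact absurd ⟨p', hp'⟩ (h v)
      · exact absurd ⟨p, hp⟩ (h v)
      · exact absurd ⟨p, hp⟩ (h v)
    infer_instance
  · have : ∀ e : {e // D.tgt e = v}, Finite {p // D.IsWalk s (D.src e) p} :=
      fun e => ih _ ⟨e, rfl, e.2⟩
    exact Finite.of_equiv _ (D.walkEquiv hv)

theorem Acyclic.mu_eq_sum (h : D.Acyclic) {s v : Fin m} (hs : D.indeg s = 0) (hv : v ≠ s) :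
    D.mu s v = ∑ e with D.tgt e = v, D.mu s (D.src e) := by
  have := fun v => h.finite_walks hs v
  simp only [h.mu_eq_card s]
  rw [← Nat.card_congr (D.walkEquiv hv), Nat.card_sigma]
  exact (Finset.sum_subtype (Finset.univ.filter fun e => D.tgt e = v) (by simp)
    fun e => Nat.card {p // D.IsWalk s (D.src e) p}).symm

/-- The numbers of paths from `s` along each of the edges leaving the vertex set `A`. -/
noncomputable def cut (D : Multigraph m q) (s : Fin m) (A : Finset (Fin m)) : Multiset ℕ :=
  (Finset.univ.filter fun e => D.src e ∈ A ∧ D.tgt e ∉ A).val.map fun e => D.mu s (D.src e)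

/-- Adding a vertex `v`, all of whose in-edges come from `A`, to a set `A` of vertices that is
closed under predecessors. -/
theorem Acyclic.cut_insert (h : D.Acyclic) {s v : Fin m} {A : Finset (Fin m)}
    (hA : ∀ e, D.tgt e ∈ A → D.src e ∈ A) (hvA : v ∉ A) (hv : ∀ e, D.tgt e = v → D.src e ∈ A) :
    ∃ R : Multiset ℕ,
      D.cut s A = (Finset.univ.filter fun e => D.tgt e = v).val.map (fun e => D.mu s (D.src e)) + R ∧
      D.cut s (insert v A) = Multiset.replicate (D.outdeg v) (D.mu s v) + R := by
  refine ⟨(Finset.univ.filter fun e => D.src e ∈ A ∧ D.tgt e ∉ insert v A).val.map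
    fun e => D.mu s (D.src e), ?_, ?_⟩
  · rw [cut, ← Multiset.map_add]
    rw [← Finset.disjUnion_val _ _ (by
      rw [Finset.disjoint_left]
      intro e he he'
      simp_all)]
    congr 2
    ext e
    have := hv e
    simp only [Finset.mem_filter, Finset.mem_univ, true_and, Finset.mem_disjUnion,
      Finset.mem_insert, not_or]
    by_cases he : D.tgt e = v
    · simp [he, this he, hvA]
    · simp [he]
  · have hout : Multiset.replicate (D.outdeg v) (D.mu s v) =
        (Finset.univ.filter fun e => D.src e = v).val.map fun e => D.mu s (D.src e) := by
      symm
      rw [Multiset.eq_replicate]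
      constructor
      · rw [Multiset.card_map, Finset.card_val, outdeg]
      · intro b hb
        simp only [Multiset.mem_map, Finset.mem_val, Finset.mem_filter, Finset.mem_univ,
          true_and] at hb
        obtain ⟨e, rfl, rfl⟩ := hb
        rfl
    rw [hout, cut, ← Multiset.map_add]
    rw [← Finset.disjUnion_val _ _ (by
      rw [Finset.disjoint_left]
      intro e he he'
      simp_all)]
    congr 2
    ext e
    simp only [Finset.mem_filter, Finset.mem_univ, true_and, Finset.mem_disjUnion,
      Finset.mem_insert, not_or]
    by_cases he : D.src e = v
    · have h1 : D.tgt e ≠ v := fun h' =>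
        h v ⟨[] ++ [e], isPath_concat_iff.mpr ⟨h', Or.inl ⟨rfl, he⟩⟩⟩
      have h2 : D.tgt e ∉ A := fun h' => hvA (he ▸ hA e h')
      simp [he, h1, h2]
    · simp [he]

theorem Acyclic.exists_evolves (hacy : D.Acyclic) (hreg : D.ThreeRegular) {s t : Fin m}
    (hs : D.UniqueSource s) (ht : D.UniqueSink t) (A : Finset (Fin m))
    (hA : ∀ e, D.tgt e ∈ A → D.src e ∈ A) (hsA : s ∈ A) (htA : t ∉ A) :
    ∃ k l, k + l + 1 = Aᶜ.card ∧ Evolves k l (D.cut s A) (D.cut s {t}ᶜ) := by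
  induction hc : Aᶜ.card generalizing A with
  | zero =>
    rw [Finset.card_eq_zero] at hc
    simp_all
  | succ c ih =>
    by_cases hAt : ∃ v, v ∉ A ∧ v ≠ t
    · obtain ⟨v, ⟨hvA, hvt⟩, hmin⟩ := hacy.wellFounded.has_min {v | v ∉ A ∧ v ≠ t} hAt
      have hv : ∀ e, D.tgt e = v → D.src e ∈ A := by
        intro e he
        by_contra hcon
        refine hmin (D.src e) ⟨hcon, fun h => ?_⟩ ⟨e, rfl, he⟩
        have h0 := ht.1
        rw [outdeg, Finset.card_eq_zero] at h0
        exact Finset.notMem_empty e (h0 ▸ by simpa using h)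
      have hvs : v ≠ s := fun h => hvA (h ▸ hsA)
      have hcard : (insert v A)ᶜ.card = c := by
        rw [Finset.compl_insert, Finset.card_erase_of_mem (by simpa using hvA), hc]
        rfl
      obtain ⟨k, l, hkl, hev⟩ := ih (insert v A)
        (by
          intro e he
          rw [Finset.mem_insert] at he ⊢
          rcases he with he | he
          · exact Or.inr (hv e he)
          · exact Or.inr (hA e he))
        (by simp [hsA]) (by simp [htA, hvt.symm]) hcard
      obtain ⟨R, hR, hR'⟩ := hacy.cut_insert (s := s) hA hvA hv
      have hi : D.indeg v ≠ 0 := fun h => hvs (hs.2 v h)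
      have ho : D.outdeg v ≠ 0 := fun h => hvt (ht.2 v h)
      have hr := hreg v
      have hmu := hacy.mu_eq_sum hs.1 hvs
      rw [Finset.sum] at hmu
      rw [hR]
      rw [hR', hmu] at hev
      have hIn : ((Finset.univ.filter fun e => D.tgt e = v).val.map
        fun e => D.mu s (D.src e)).card = D.indeg v := by
        rw [Multiset.card_map, Finset.card_val, indeg]
      generalize (Finset.univ.filter fun e => D.tgt e = v).val.map
        (fun e => D.mu s (D.src e)) = I at *
      have hcases : D.indeg v = 1 ∧ D.outdeg v = 2 ∨ D.indeg v = 2 ∧ D.outdeg v = 1 := by omega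
      rcases hcases with ⟨h1, h2⟩ | ⟨h1, h2⟩
      · rw [h1] at hIn
        obtain ⟨x, rfl⟩ := Multiset.card_eq_one.mp hIn
        refine ⟨k + 1, l, by omega, ?_⟩
        rw [Multiset.singleton_add]
        refine Evolves.split x R ?_
        simpa [h2, Multiset.replicate_succ] using hev
      · rw [h1] at hIn
        obtain ⟨x, y, rfl⟩ := Multiset.card_eq_two.mp hIn
        refine ⟨k, l + 1, by omega, ?_⟩
        rw [Multiset.insert_eq_cons, Multiset.cons_add, Multiset.singleton_add]
        refine Evolves.merge x y R ?_
        simpa [h2, Multiset.replicate_succ] using hev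
    · obtain rfl : A = {t}ᶜ := by
        ext v
        simp only [Finset.mem_compl, Finset.mem_singleton]
        push Not at hAt
        exact ⟨fun h h' => htA (h' ▸ h), fun h => by_contra fun h' => h (hAt v h')⟩
      refine ⟨0, 0, ?_, .refl _⟩
      simpa using hc

theorem cut_compl_sink (hacy : D.Acyclic) (s t : Fin m) :
    D.cut s {t}ᶜ = (Finset.univ.filter fun e => D.tgt e = t).val.map
      fun e => D.mu s (D.src e) := by
  unfold cut
  congr 2
  ext e
  simp only [Finset.mem_filter, Finset.mem_univ, true_and, Finset.mem_compl,
    Finset.mem_singleton, not_not, and_iff_right_iff_imp]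
  intro h h'
  exact hacy t ⟨[] ++ [e], isPath_concat_iff.mpr ⟨h, Or.inl ⟨rfl, h'⟩⟩⟩

theorem cut_singleton_source (hacy : D.Acyclic) (s : Fin m) :
    D.cut s {s} = Multiset.replicate (D.outdeg s) 1 := by
  rw [Multiset.eq_replicate]
  constructor
  · simp only [cut, Multiset.card_map, outdeg, Finset.card_val]
    congr 1
    ext e
    simp only [Finset.mem_filter, Finset.mem_univ, true_and, Finset.mem_singleton,
      and_iff_left_iff_imp]
    intro h h'
    exact hacy s ⟨[] ++ [e], isPath_concat_iff.mpr ⟨h', Or.inl ⟨rfl, h⟩⟩⟩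
  · intro b hb
    simp only [cut, Multiset.mem_map, Finset.mem_val, Finset.mem_filter, Finset.mem_univ,
      true_and, Finset.mem_singleton] at hb
    obtain ⟨e, ⟨he, -⟩, rfl⟩ := hb
    simp [mu, he]

end Multigraph

/-- For `n ≥ 3`, every 3-regular, weakly connected, acyclic finite directed
multigraph on `2n` vertices with a unique source and a unique sink has at most
`9 · 2 ^ (n - 3)` source-to-sink paths. -/
theorem connected_upper_bound (n : ℕ) (hn : 3 ≤ n) (q : ℕ) (D : Multigraph (2 * n) q)
    (s t : Fin (2 * n)) (hreg : D.ThreeRegular) (hwc : D.WeaklyConnected)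
    (hacy : D.Acyclic) (hs : D.UniqueSource s) (ht : D.UniqueSink t) :
    D.mu s t ≤ 9 * 2 ^ (n - 3) := by
  have hs3 : D.outdeg s = 3 := by have := hreg s; have := hs.1; omega
  have ht3 : D.indeg t = 3 := by have := hreg t; have := ht.1; omega
  have hts : t ≠ s := by
    rintro rfl
    have := ht.1
    omega
  obtain ⟨k, l, hkl, hev⟩ := hacy.exists_evolves hreg hs ht {s}
    (by
      intro e he
      have h0 := hs.1
      rw [Multigraph.indeg, Finset.card_eq_zero] at h0
      exact absurd (h0 ▸ by simpa using he : e ∈ (∅ : Finset (Fin q))) (Finset.notMem_empty e))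
    (by simp) (by simpa using hts)
  rw [Multigraph.cut_singleton_source hacy, hs3, Multigraph.cut_compl_sink hacy] at hev
  have hN : ((Finset.univ.filter fun e => D.tgt e = t).val.map
      fun e => D.mu s (D.src e)).card = 3 := by
    rwa [Multiset.card_map, Finset.card_val]
  have hcount := hev.card_add
  rw [hN, Multiset.card_replicate] at hcount
  rw [Finset.card_compl, Finset.card_singleton, Fintype.card_fin] at hkl
  have hbound := hev.sum_le_of_replicate_three_one rfl hN (by omega)
  rw [hacy.mu_eq_sum hs.1 hts, Finset.sum]
  obtain ⟨d, rfl⟩ := Nat.exists_eq_add_of_le hn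
  rw [show k = d + 2 by omega, pow_add] at hbound
  rw [Nat.add_sub_cancel_left]
  omega
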